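/- For all odd integers s, t with s ≥ t ≥ 7, the toroidal grid T_{s,t} satisfies mbt(T_{s,t}) = 5; equivalently, T_{s,t} is nearly dispersable. -/

import Mathlib

open SimpleGraph

/-- Two chords of a circle, given by positions of their endpoints along the circle,
cross: their endpoint pairs interleave. -/
def chordsCross (a b c d : ℕ) : Prop :=
  (min a b < min c d ∧ min c d < max a b ∧ max a b < max c d) ∨
  (min c d < min a b ∧ min a b < max c d ∧ max c d < max a b)

/-- Two edges cross with respect to a position function `f` on the vertices. -/
def edgesCross {V : Type*} (f : V → ℕ) (e e' : Sym2 V) : Prop :=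
  ∃ a b c d, e = s(a, b) ∧ e' = s(c, d) ∧ chordsCross (f a) (f b) (f c) (f d)

/-- `(f, c)` is a matching book embedding of `G`: the edge coloring `c` is proper and
edges that cross in the cyclic ordering given by `f` receive distinct colors. -/
def IsMBE {V : Type*} [Fintype V] (G : SimpleGraph V)
    (f : V ≃ Fin (Fintype.card V)) {m : ℕ} (c : G.edgeSet → Fin m) : Prop :=
  (∀ e₁ e₂ : G.edgeSet, e₁ ≠ e₂ → (∃ v, v ∈ (e₁ : Sym2 V) ∧ v ∈ (e₂ : Sym2 V)) →
      c e₁ ≠ c e₂) ∧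
  (∀ e₁ e₂ : G.edgeSet,
      edgesCross (fun v => (f v : ℕ)) (e₁ : Sym2 V) (e₂ : Sym2 V) → c e₁ ≠ c e₂)

/-- `G` has an `m`-page matching book embedding. -/
def HasMBE {V : Type*} [Fintype V] (G : SimpleGraph V) (m : ℕ) : Prop :=
  ∃ (f : V ≃ Fin (Fintype.card V)) (c : G.edgeSet → Fin m), IsMBE G f c

/-- The matching book thickness of `G`. -/
noncomputable def mbt {V : Type*} [Fintype V] (G : SimpleGraph V) : ℕ :=
  sInf {m | HasMBE G m}

/-- The toroidal grid `T_{s,t} = C_s □ C_t`. -/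
def toroidalGrid (s t : ℕ) : SimpleGraph (Fin s × Fin t) :=
  (cycleGraph s) □ (cycleGraph t)

/-! ### The construction, in terms of natural numbers -/

/-- Position of column `j` inside row `m`. -/
def tgQ (t m j : ℕ) : ℕ :=
  if m % 2 = 0 then (if min m (t - 1) ≤ j then j - min m (t - 1) else t - 1 - j)
  else (if j < min m (t - 1) then j else min m (t - 1) + (t - 1 - j))

/-- Color of the edge from `(m, j)` to `(m, j + 1)`. -/
def tgH (s t m j : ℕ) : ℕ :=
  if 2 ≤ m ∧ m + 2 ≤ t then
    if m < j then (if j % 2 = 1 then 0 else 4 - m % 2)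
    else if j = m then 3 + m % 2
    else if j + 1 = m then 0
    else if j = 0 then (if m = 2 then 1 else 3 + m % 2)
    else if j % 2 = m % 2 then 4 - m % 2 else 0
  else if j = 0 then 3 + m % 2
  else if j % 2 = 0 then 4 - m % 2
  else if m = 0 then 1 else if m + 1 = s then 2 else 0

/-- Color of the edge from `(m, j)` to `(m + 1, j)`. -/
def tgU (s t m j : ℕ) : ℕ :=
  if m + 1 = s then 0
  else if j = m ∧ m + 2 ≤ t then (if m = 0 then 1 else 4 - m % 2)
  else if m = 1 ∧ j = 0 then 0
  else 2 - m % 2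

theorem tgH_lt (s t m j : ℕ) : tgH s t m j < 5 := by
  unfold tgH; split_ifs <;> first | contradiction | omega

theorem tgU_lt (s t m j : ℕ) : tgU s t m j < 5 := by
  unfold tgU; split_ifs <;> omega

theorem tgQ_lt {t m j : ℕ} (hj : j < t) : tgQ t m j < t := by
  unfold tgQ; split_ifs <;> omega

theorem tgQ_inj {t m j j' : ℕ} (hj : j < t) (hj' : j' < t)
    (h : tgQ t m j = tgQ t m j') : j = j' := by
  unfold tgQ at h; split_ifs at h <;> omega

theorem tgQ_short {t m j : ℕ} (hj : j + 1 < t) (hk : j + 1 ≠ min m (t - 1)) :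
    tgQ t m (j + 1) = tgQ t m j + 1 ∨ tgQ t m j = tgQ t m (j + 1) + 1 := by
  unfold tgQ; split_ifs <;> omega

theorem tgH_succ {s t m j : ℕ} (ht : 7 ≤ t) (hto : t % 2 = 1) (hj : j + 1 < t) :
    tgH s t m j ≠ tgH s t m (j + 1) := by
  unfold tgH; split_ifs <;> first | contradiction | omega

theorem tgH_wrap {s t m : ℕ} (ht : 7 ≤ t) (hto : t % 2 = 1) :
    tgH s t m (t - 1) ≠ tgH s t m 0 := by
  unfold tgH; split_ifs <;> first | contradiction | omega

theorem tgH_long {s t m j : ℕ} (ht : 7 ≤ t) (hto : t % 2 = 1)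
    (hj : j + 1 = min m (t - 1)) :
    tgH s t m j ≠ tgH s t m (t - 1) := by
  unfold tgH; split_ifs <;> first | contradiction | omega

/-- Lower endpoint of a vertical edge against horizontal edges of its row. -/
theorem tgHU_low {s t m j j' : ℕ} (ht : 7 ≤ t) (hto : t % 2 = 1) (hst : t ≤ s)
    (hso : s % 2 = 1) (hm : m < s)
    (hj : j < t) (hj' : j' < t) (h : tgH s t m j = tgU s t m j') :
    j' ≠ j ∧ j' ≠ j + 1 ∧ (j + 1 = t → j' ≠ 0) ∧
    ((j + 1 ≠ t ∧ j + 1 ≠ min m (t - 1)) ∨ tgQ t m j' = 0 ∨ tgQ t m j' + 1 = t) := by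
  unfold tgH tgU at h
  unfold tgQ
  split_ifs at h <;> first | contradiction | omega | (split_ifs <;> omega)

/-- Upper endpoint of a vertical edge against horizontal edges of its row. -/
theorem tgHU_up {s t m j j' : ℕ} (ht : 7 ≤ t) (hto : t % 2 = 1) (hst : t ≤ s)
    (hso : s % 2 = 1) (hm : m + 1 < s)
    (hj : j < t) (hj' : j' < t) (h : tgH s t (m + 1) j = tgU s t m j') :
    j' ≠ j ∧ j' ≠ j + 1 ∧ (j + 1 = t → j' ≠ 0) ∧
    ((j + 1 ≠ t ∧ j + 1 ≠ min (m + 1) (t - 1)) ∨ tgQ t (m + 1) j' = 0 ∨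
      tgQ t (m + 1) j' + 1 = t) := by
  unfold tgH tgU at h
  unfold tgQ
  split_ifs at h <;> first | contradiction | omega | (split_ifs <;> omega)

theorem tgHU_wrap {s t j j' : ℕ} (ht : 7 ≤ t) (hst : t ≤ s) :
    tgH s t 0 j ≠ tgU s t (s - 1) j' := by
  unfold tgH tgU; split_ifs <;> omega

set_option maxHeartbeats 2000000 in
/-- Same gap: equal colors imply nesting. -/
theorem tgUU_same {s t m j j' : ℕ} (ht : 7 ≤ t) (hto : t % 2 = 1) (hst : t ≤ s)
    (hso : s % 2 = 1) (hm : m + 1 < s)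
    (hj : j < t) (hj' : j' < t) (hne : j ≠ j') (h : tgU s t m j = tgU s t m j') :
    (tgQ t m j < tgQ t m j' ∧ tgQ t (m + 1) j' < tgQ t (m + 1) j) ∨
    (tgQ t m j' < tgQ t m j ∧ tgQ t (m + 1) j < tgQ t (m + 1) j') := by
  unfold tgU at h
  unfold tgQ
  split_ifs at h <;> first | contradiction | omega | (split_ifs <;> omega)

/-- Consecutive gaps: equal colors imply disjointness. -/
theorem tgUU_succ {s t m j j' : ℕ} (ht : 7 ≤ t) (hto : t % 2 = 1) (hst : t ≤ s)
    (hso : s % 2 = 1) (hm : m + 2 < s)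
    (hj : j < t) (hj' : j' < t) (h : tgU s t m j = tgU s t (m + 1) j') :
    tgQ t (m + 1) j < tgQ t (m + 1) j' := by
  unfold tgU at h
  unfold tgQ
  split_ifs at h <;> first | contradiction | omega | (split_ifs <;> omega)

theorem tgUU_wrap_low {s t j j' : ℕ} (ht : 7 ≤ t) (hst : t ≤ s) (hso : s % 2 = 1) :
    tgU s t 0 j ≠ tgU s t (s - 1) j' := by
  unfold tgU; split_ifs <;> omega

theorem tgUU_wrap_high {s t j j' : ℕ} (ht : 7 ≤ t) (hst : t ≤ s) (hso : s % 2 = 1) :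
    tgU s t (s - 2) j ≠ tgU s t (s - 1) j' := by
  unfold tgU; split_ifs <;> omega

theorem tgQ_zero {t j : ℕ} : tgQ t 0 j = j := by
  unfold tgQ; split_ifs <;> omega

theorem tgQ_last {s t j : ℕ} (ht : 7 ≤ t) (hst : t ≤ s) (hso : s % 2 = 1) (hj : j < t) :
    tgQ t (s - 1) j = t - 1 - j := by
  unfold tgQ; split_ifs <;> omega

/-- Global position of vertex `(m, j)`. -/
def tgPos (t m j : ℕ) : ℕ := m * t + tgQ t m j

/-- Two chords that neither share an end nor cross. -/
def tgOk (a b c d : ℕ) : Prop :=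
  a ≠ c ∧ a ≠ d ∧ b ≠ c ∧ b ≠ d ∧ ¬ chordsCross a b c d

theorem tgOk_symm {a b c d : ℕ} (h : tgOk a b c d) : tgOk c d a b := by
  unfold tgOk chordsCross at *; omega

theorem tg_row {t m m' : ℕ} (h : m < m') : m * t + t ≤ m' * t := by
  have := Nat.mul_le_mul_right t (Nat.succ_le_of_lt h)
  rwa [Nat.succ_mul] at this

theorem tg_next {t j : ℕ} (hj : j < t) :
    (j + 1 < t ∧ (j + 1) % t = j + 1) ∨ (j + 1 = t ∧ (j + 1) % t = 0) := by
  rcases Nat.lt_or_ge (j + 1) t with h | h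
  · exact Or.inl ⟨h, Nat.mod_eq_of_lt h⟩
  · have : j + 1 = t := by omega
    exact Or.inr ⟨this, by rw [this, Nat.mod_self]⟩

theorem tgHH {s t m j m' j' : ℕ} (ht : 7 ≤ t) (hto : t % 2 = 1)
    (hj : j < t) (hj' : j' < t) (hne : m ≠ m' ∨ j ≠ j')
    (h : tgH s t m j = tgH s t m' j') :
    tgOk (tgPos t m j) (tgPos t m ((j + 1) % t))
      (tgPos t m' j') (tgPos t m' ((j' + 1) % t)) := by
  have hn : (j + 1) % t < t := Nat.mod_lt _ (by omega)
  have hn' : (j' + 1) % t < t := Nat.mod_lt _ (by omega)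
  have b1 := tgQ_lt (m := m) hj
  have b2 := tgQ_lt (m := m) hn
  have b3 := tgQ_lt (m := m') hj'
  have b4 := tgQ_lt (m := m') hn'
  rcases lt_trichotomy m m' with hm | rfl | hm
  · have := tg_row (t := t) hm
    unfold tgOk chordsCross tgPos; omega
  · have hne : j ≠ j' := by tauto
    have e1 : j' ≠ (j + 1) % t := by
      rintro rfl
      rcases tg_next hj with ⟨h1, h2⟩ | ⟨h1, h2⟩
      · rw [h2] at h; exact tgH_succ ht hto h1 h
      · rw [h2] at h
        have : j = t - 1 := by omega
        subst this; exact tgH_wrap ht hto h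
    have e2 : j ≠ (j' + 1) % t := by
      rintro rfl
      rcases tg_next hj' with ⟨h1, h2⟩ | ⟨h1, h2⟩
      · rw [h2] at h; exact tgH_succ ht hto h1 h.symm
      · rw [h2] at h
        have : j' = t - 1 := by omega
        subst this; exact tgH_wrap ht hto h.symm
    have e3 : (j + 1) % t ≠ (j' + 1) % t := by
      rcases tg_next hj with ⟨h1, h2⟩ | ⟨h1, h2⟩ <;>
      rcases tg_next hj' with ⟨h3, h4⟩ | ⟨h3, h4⟩ <;> omega
    have q1 : tgQ t m j ≠ tgQ t m j' := fun e => hne (tgQ_inj hj hj' e)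
    have q2 : tgQ t m ((j + 1) % t) ≠ tgQ t m j' := fun e => e1 (tgQ_inj hn hj' e).symm
    have q3 : tgQ t m j ≠ tgQ t m ((j' + 1) % t) := fun e => e2 (tgQ_inj hj hn' e)
    have q4 : tgQ t m ((j + 1) % t) ≠ tgQ t m ((j' + 1) % t) :=
      fun e => e3 (tgQ_inj hn hn' e)
    by_cases s1 : j + 1 < t ∧ j + 1 ≠ min m (t - 1)
    · have := tgQ_short s1.1 s1.2
      rw [Nat.mod_eq_of_lt s1.1] at *
      unfold tgOk chordsCross tgPos; omega
    by_cases s2 : j' + 1 < t ∧ j' + 1 ≠ min m (t - 1)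
    · have := tgQ_short s2.1 s2.2
      rw [Nat.mod_eq_of_lt s2.1] at *
      unfold tgOk chordsCross tgPos; omega
    exfalso
    rcases (by omega : (j + 1 = min m (t - 1) ∧ j' = t - 1) ∨
      (j' + 1 = min m (t - 1) ∧ j = t - 1)) with ⟨h1, h2⟩ | ⟨h1, h2⟩
    · rw [h2] at h; exact tgH_long ht hto h1 h
    · rw [h2] at h; exact tgH_long ht hto h1 h.symm
  · have := tg_row (t := t) hm
    unfold tgOk chordsCross tgPos; omega

/-- A horizontal edge of row `m` against an edge with one end in row `m` and one outside. -/
theorem tg_aux {t m j j' y : ℕ} (ht : 7 ≤ t) (hj : j < t) (hj' : j' < t)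
    (hy : y < m * t ∨ m * t + t ≤ y)
    (h : j' ≠ j ∧ j' ≠ j + 1 ∧ (j + 1 = t → j' ≠ 0) ∧
    ((j + 1 ≠ t ∧ j + 1 ≠ min m (t - 1)) ∨ tgQ t m j' = 0 ∨ tgQ t m j' + 1 = t)) :
    tgOk (tgPos t m j) (tgPos t m ((j + 1) % t)) (tgPos t m j') y := by
  have hn : (j + 1) % t < t := Nat.mod_lt _ (by omega)
  have b1 := tgQ_lt (m := m) hj
  have b2 := tgQ_lt (m := m) hn
  have b3 := tgQ_lt (m := m) hj'
  obtain ⟨h1, h2, h3, h4⟩ := h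
  have e1 : j' ≠ (j + 1) % t := by
    rcases tg_next hj with ⟨a, b⟩ | ⟨a, b⟩
    · omega
    · rw [b]; exact h3 a
  have q1 : tgQ t m j ≠ tgQ t m j' := fun e => h1 (tgQ_inj hj hj' e).symm
  have q2 : tgQ t m ((j + 1) % t) ≠ tgQ t m j' := fun e => e1 (tgQ_inj hn hj' e).symm
  rcases h4 with ⟨a, b⟩ | a
  · have a' : j + 1 < t := by omega
    have := tgQ_short a' b
    rw [Nat.mod_eq_of_lt a'] at *
    unfold tgOk chordsCross tgPos; omega
  · unfold tgOk chordsCross tgPos; omega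

theorem tgOk_swap {a b c d : ℕ} (h : tgOk a b c d) : tgOk a b d c := by
  unfold tgOk chordsCross at *; omega

theorem tgHU {s t m j m' j' : ℕ} (ht : 7 ≤ t) (hto : t % 2 = 1) (hst : t ≤ s)
    (hso : s % 2 = 1) (hm : m < s) (hm' : m' < s)
    (hj : j < t) (hj' : j' < t)
    (h : tgH s t m j = tgU s t m' j') :
    tgOk (tgPos t m j) (tgPos t m ((j + 1) % t))
      (tgPos t m' j') (tgPos t ((m' + 1) % s) j') := by
  have hn : (j + 1) % t < t := Nat.mod_lt _ (by omega)
  have b1 := tgQ_lt (m := m) hj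
  have b2 := tgQ_lt (m := m) hn
  have b3 := tgQ_lt (m := m') hj'
  have b4 := tgQ_lt (m := (m' + 1) % s) hj'
  have key : ∀ x, x ≠ m → tgPos t x j' < m * t ∨ m * t + t ≤ tgPos t x j' := by
    intro x hx
    have := tgQ_lt (m := x) hj'
    rcases lt_or_gt_of_ne hx with h | h
    · have := tg_row (t := t) h
      unfold tgPos; omega
    · have := tg_row (t := t) h
      unfold tgPos; omega
  have hnx : (m' + 1) % s ≠ m' := by
    rcases tg_next hm' with ⟨a, b⟩ | ⟨a, b⟩ <;> omega
  by_cases c1 : m' = m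
  · subst c1
    exact tg_aux ht hj hj' (key _ hnx) (tgHU_low ht hto hst hso hm hj hj' h)
  by_cases c2 : (m' + 1) % s = m
  · rcases tg_next hm' with ⟨a, b⟩ | ⟨a, b⟩
    · have : m = m' + 1 := by omega
      subst this
      rw [b]
      exact tgOk_swap (tg_aux ht hj hj' (key _ c1) (tgHU_up ht hto hst hso hm hj hj' h))
    · have h0 : m = 0 := by omega
      have h1 : m' = s - 1 := by omega
      subst h0 h1
      exact absurd h (tgHU_wrap ht hst)
  have k1 := key _ c1
  have k2 := key _ c2
  have p1 : tgPos t m j = m * t + tgQ t m j := rfl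
  have p2 : tgPos t m ((j + 1) % t) = m * t + tgQ t m ((j + 1) % t) := rfl
  unfold tgOk chordsCross; omega

theorem tgUU_lt {s t m j m' j' : ℕ} (ht : 7 ≤ t) (hto : t % 2 = 1) (hst : t ≤ s)
    (hso : s % 2 = 1) (hmm : m < m') (hm' : m' < s)
    (hj : j < t) (hj' : j' < t)
    (h : tgU s t m j = tgU s t m' j') :
    tgOk (tgPos t m j) (tgPos t ((m + 1) % s) j)
      (tgPos t m' j') (tgPos t ((m' + 1) % s) j') := by
  have hm1 : (m + 1) % s = m + 1 := Nat.mod_eq_of_lt (by omega)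
  rw [hm1]
  have b1 := tgQ_lt (m := m) hj
  have b2 := tgQ_lt (m := m + 1) hj
  have b3 := tgQ_lt (m := m') hj'
  have r0 := tg_row (t := t) (show m < m + 1 by omega)
  rcases tg_next hm' with ⟨a, b⟩ | ⟨a, b⟩
  · rw [b]
    have b4 := tgQ_lt (m := m' + 1) hj'
    have r1 := tg_row (t := t) (show m' < m' + 1 by omega)
    by_cases c : m' = m + 1
    · subst c
      have := tgUU_succ ht hto hst hso a hj hj' h
      unfold tgOk chordsCross tgPos; omega
    · have r2 := tg_row (t := t) (show m + 1 < m' by omega)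
      unfold tgOk chordsCross tgPos; omega
  · rw [b]
    have b4 := tgQ_lt (m := 0) hj'
    have e : m' = s - 1 := by omega
    subst e
    have c1 : m ≠ 0 := by
      rintro rfl; exact tgUU_wrap_low ht hst hso h
    have c2 : m ≠ s - 2 := by
      rintro rfl; exact tgUU_wrap_high ht hst hso h
    have r2 := tg_row (t := t) (show m + 1 < s - 1 by omega)
    have r3 := tg_row (t := t) (show 0 < m by omega)
    unfold tgOk chordsCross tgPos; omega

theorem tgUU_eq {s t m j j' : ℕ} (ht : 7 ≤ t) (hto : t % 2 = 1) (hst : t ≤ s)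
    (hso : s % 2 = 1) (hm : m < s)
    (hj : j < t) (hj' : j' < t) (hne : j ≠ j')
    (h : tgU s t m j = tgU s t m j') :
    tgOk (tgPos t m j) (tgPos t ((m + 1) % s) j)
      (tgPos t m j') (tgPos t ((m + 1) % s) j') := by
  have b1 := tgQ_lt (m := m) hj
  have b3 := tgQ_lt (m := m) hj'
  rcases tg_next hm with ⟨a, b⟩ | ⟨a, b⟩
  · rw [b]
    have b2 := tgQ_lt (m := m + 1) hj
    have b4 := tgQ_lt (m := m + 1) hj'
    have r0 := tg_row (t := t) (show m < m + 1 by omega)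
    have := tgUU_same ht hto hst hso a hj hj' hne h
    unfold tgOk chordsCross tgPos; omega
  · rw [b]
    have e : m = s - 1 := by omega
    subst e
    have r3 := tg_row (t := t) (show 0 < s - 1 by omega)
    have z1 := tgQ_zero (t := t) (j := j)
    have z2 := tgQ_zero (t := t) (j := j')
    have z3 := tgQ_last ht hst hso hj
    have z4 := tgQ_last ht hst hso hj'
    unfold tgOk chordsCross tgPos; omega

theorem tg_cycle_adj {n : ℕ} (hn : 2 ≤ n) {u v : Fin n} (h : (cycleGraph n).Adj u v) :
    (v : ℕ) = (u + 1) % n ∨ (u : ℕ) = (v + 1) % n := by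
  rw [cycleGraph_adj'] at h
  have hu := u.isLt
  have hv := v.isLt
  have h1 := tg_next hu
  have h2 := tg_next hv
  rcases h with h | h
  · right
    rw [Fin.sub_def] at h
    simp only at h
    by_cases c : (v : ℕ) ≤ u
    · have e : n - (v : ℕ) + u = (u - v) + n := by omega
      rw [e, Nat.add_mod_right, Nat.mod_eq_of_lt (by omega)] at h
      omega
    · rw [Nat.mod_eq_of_lt (by omega)] at h
      omega
  · left
    rw [Fin.sub_def] at h
    simp only at h
    by_cases c : (u : ℕ) ≤ v
    · have e : n - (u : ℕ) + v = (v - u) + n := by omega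
      rw [e, Nat.add_mod_right, Nat.mod_eq_of_lt (by omega)] at h
      omega
    · rw [Nat.mod_eq_of_lt (by omega)] at h
      omega

/-- The number-level description of an edge: `true` is horizontal, `false` is vertical. -/
def tgCode (s t : ℕ) (x y : Fin s × Fin t) (k : Bool × ℕ × ℕ) : Prop :=
  k.2.1 < s ∧ k.2.2 < t ∧ (x.1 : ℕ) = k.2.1 ∧ (x.2 : ℕ) = k.2.2 ∧
    ((k.1 = true ∧ (y.1 : ℕ) = k.2.1 ∧ (y.2 : ℕ) = (k.2.2 + 1) % t) ∨
     (k.1 = false ∧ (y.1 : ℕ) = (k.2.1 + 1) % s ∧ (y.2 : ℕ) = k.2.2))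

def tgCol (s t : ℕ) (k : Bool × ℕ × ℕ) : ℕ :=
  if k.1 = true then tgH s t k.2.1 k.2.2 else tgU s t k.2.1 k.2.2

theorem tgCol_lt (s t : ℕ) (k : Bool × ℕ × ℕ) : tgCol s t k < 5 := by
  unfold tgCol; split_ifs
  · exact tgH_lt _ _ _ _
  · exact tgU_lt _ _ _ _

theorem tgCode_exists {s t : ℕ} (hs : 2 ≤ s) (ht : 2 ≤ t) (e : (toroidalGrid s t).edgeSet) :
    ∃ k : Bool × ℕ × ℕ, ∃ x y, (e : Sym2 (Fin s × Fin t)) = s(x, y) ∧ tgCode s t x y k := by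
  obtain ⟨e, he⟩ := e
  induction e using Sym2.ind with
  | _ x y =>
    have he' : (toroidalGrid s t).Adj x y := he
    unfold toroidalGrid at he'
    rw [boxProd_adj] at he'
    rcases he' with ⟨h1, h2⟩ | ⟨h1, h2⟩
    · rcases tg_cycle_adj hs h1 with h | h
      · exact ⟨(false, x.1, x.2), x, y, rfl, x.1.isLt, x.2.isLt, rfl, rfl,
          Or.inr ⟨rfl, h, by rw [h2]⟩⟩
      · exact ⟨(false, y.1, y.2), y, x, Sym2.eq_swap, y.1.isLt, y.2.isLt, rfl, rfl,
          Or.inr ⟨rfl, h, by rw [h2]⟩⟩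
    · rcases tg_cycle_adj ht h1 with h | h
      · exact ⟨(true, x.1, x.2), x, y, rfl, x.1.isLt, x.2.isLt, rfl, rfl,
          Or.inl ⟨rfl, by rw [h2], h⟩⟩
      · exact ⟨(true, y.1, y.2), y, x, Sym2.eq_swap, y.1.isLt, y.2.isLt, rfl, rfl,
          Or.inl ⟨rfl, by rw [h2], h⟩⟩

theorem tgCode_ok {s t : ℕ} (ht : 7 ≤ t) (hto : t % 2 = 1) (hst : t ≤ s) (hso : s % 2 = 1)
    {x y x' y' : Fin s × Fin t} {k k' : Bool × ℕ × ℕ} (h : tgCode s t x y k)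
    (h' : tgCode s t x' y' k') (hc : tgCol s t k = tgCol s t k')
    (hne : s(x, y) ≠ s(x', y')) :
    tgOk (tgPos t x.1 x.2) (tgPos t y.1 y.2) (tgPos t x'.1 x'.2) (tgPos t y'.1 y'.2) := by
  obtain ⟨b, m, j⟩ := k
  obtain ⟨b', m', j'⟩ := k'
  obtain ⟨hm, hj, h1, h2, h3⟩ := h
  obtain ⟨hm', hj', h1', h2', h3'⟩ := h'
  simp only at hm hj h1 h2 h3 hm' hj' h1' h2' h3'
  have hxy : ∀ (_ : m = m') (_ : j = j'), x = x' := fun a b =>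
    Prod.ext (Fin.ext (by omega)) (Fin.ext (by omega))
  rw [h1, h2, h1', h2']
  rcases h3 with ⟨rfl, h3, h4⟩ | ⟨rfl, h3, h4⟩ <;>
  rcases h3' with ⟨rfl, h3', h4'⟩ | ⟨rfl, h3', h4'⟩ <;>
  simp only [tgCol, if_true, Bool.false_eq_true, if_false] at hc <;>
  rw [h3, h4, h3', h4']
  · refine tgHH ht hto hj hj' ?_ hc
    by_contra hcon
    push Not at hcon
    obtain ⟨rfl, rfl⟩ := hcon
    apply hne
    rw [hxy rfl rfl, show y = y' from Prod.ext (Fin.ext (by omega)) (Fin.ext (by omega))]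
  · exact tgHU ht hto hst hso hm hm' hj hj' hc
  · exact tgOk_symm (tgHU ht hto hst hso hm' hm hj' hj hc.symm)
  · rcases lt_trichotomy m m' with c | rfl | c
    · exact tgUU_lt ht hto hst hso c hm' hj hj' hc
    · refine tgUU_eq ht hto hst hso hm hj hj' ?_ hc
      rintro rfl
      apply hne
      rw [hxy rfl rfl, show y = y' from Prod.ext (Fin.ext (by omega)) (Fin.ext (by omega))]
    · exact tgOk_symm (tgUU_lt ht hto hst hso c hm hj' hj hc.symm)

theorem tgPos_lt {s t m j : ℕ} (hm : m < s) (hj : j < t) : tgPos t m j < s * t := by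
  have := tg_row (t := t) hm
  have := tgQ_lt (m := m) hj
  unfold tgPos; omega

theorem tgPos_inj {t m j m' j' : ℕ} (hj : j < t) (hj' : j' < t)
    (h : tgPos t m j = tgPos t m' j') : m = m' ∧ j = j' := by
  have b := tgQ_lt (m := m) hj
  have b' := tgQ_lt (m := m') hj'
  unfold tgPos at h
  rcases lt_trichotomy m m' with c | rfl | c
  · have := tg_row (t := t) c; omega
  · exact ⟨rfl, tgQ_inj (m := m) hj hj' (by omega)⟩
  · have := tg_row (t := t) c; omega

theorem tg_upper {s t : ℕ} (ht : 7 ≤ t) (hto : t % 2 = 1) (hst : t ≤ s) (hso : s % 2 = 1) :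
    HasMBE (toroidalGrid s t) 5 := by
  have hcard : Fintype.card (Fin s × Fin t) = s * t := by simp
  let f0 : Fin s × Fin t → Fin (Fintype.card (Fin s × Fin t)) := fun v =>
    ⟨tgPos t v.1 v.2, by rw [hcard]; exact tgPos_lt v.1.isLt v.2.isLt⟩
  have hf0 : Function.Bijective f0 := by
    rw [Fintype.bijective_iff_injective_and_card]
    refine ⟨?_, by simp⟩
    intro u v huv
    have := tgPos_inj u.2.isLt v.2.isLt (congrArg Fin.val huv)
    exact Prod.ext (Fin.ext this.1) (Fin.ext this.2)
  choose k X Y hk hcode using tgCode_exists (s := s) (t := t) (by omega) (by omega)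
  have main : ∀ e₁ e₂ : (toroidalGrid s t).edgeSet, e₁ ≠ e₂ →
      tgCol s t (k e₁) = tgCol s t (k e₂) →
      tgOk (tgPos t (X e₁).1 (X e₁).2) (tgPos t (Y e₁).1 (Y e₁).2)
        (tgPos t (X e₂).1 (X e₂).2) (tgPos t (Y e₂).1 (Y e₂).2) := by
    intro e₁ e₂ hne hc
    refine tgCode_ok ht hto hst hso (hcode e₁) (hcode e₂) hc ?_
    rw [← hk, ← hk]
    exact fun h => hne (Subtype.ext h)
  refine ⟨Equiv.ofBijective f0 hf0, fun e => ⟨tgCol s t (k e), tgCol_lt _ _ _⟩, ?_, ?_⟩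
  · rintro e₁ e₂ hne ⟨v, hv1, hv2⟩ hc
    obtain ⟨n1, n2, n3, n4, -⟩ := main e₁ e₂ hne (congrArg Fin.val hc)
    rw [hk, Sym2.mem_iff] at hv1 hv2
    rcases hv1 with a | a <;> rcases hv2 with b | b
    · exact n1 (by rw [← a, ← b])
    · exact n2 (by rw [← a, ← b])
    · exact n3 (by rw [← a, ← b])
    · exact n4 (by rw [← a, ← b])
  · rintro e₁ e₂ ⟨a, b, c, d, h1, h2, hx⟩ hc
    have hcol := congrArg Fin.val hc
    simp only [Equiv.ofBijective_apply, f0] at hx hcol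
    by_cases hne : e₁ = e₂
    · subst hne
      rw [h1] at h2
      rcases Sym2.eq_iff.1 h2 with ⟨rfl, rfl⟩ | ⟨rfl, rfl⟩ <;>
      · unfold chordsCross at hx; omega
    obtain ⟨-, -, -, -, n⟩ := main e₁ e₂ hne hcol
    apply n
    rw [hk] at h1 h2
    rcases Sym2.eq_iff.1 h1 with ⟨h3, h4⟩ | ⟨h3, h4⟩ <;>
    rcases Sym2.eq_iff.1 h2 with ⟨h5, h6⟩ | ⟨h5, h6⟩ <;>
    rw [h3, h4, h5, h6] <;> unfold chordsCross at hx ⊢ <;> omega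

theorem tg_degree {s t : ℕ} (ht : 3 ≤ t) (hs : 3 ≤ s) (v : Fin s × Fin t)
    [Fintype ((toroidalGrid s t).neighborSet v)] :
    (toroidalGrid s t).degree v = 4 := by
  obtain ⟨s, rfl⟩ := Nat.exists_eq_add_of_le' hs
  obtain ⟨t, rfl⟩ := Nat.exists_eq_add_of_le' ht
  have := degree_boxProd (G := cycleGraph (s + 3)) (H := cycleGraph (t + 3)) v
  rw [cycleGraph_degree_three_le, cycleGraph_degree_three_le] at this
  convert this
  rfl

theorem tg_lower_aux {V : Type*} [Fintype V] [DecidableEq V] (G : SimpleGraph V)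
    [∀ v, Fintype (G.neighborSet v)] {m : ℕ} (hreg : ∀ v, G.degree v = 4) (v0 : V)
    (hodd : ¬ Even (Fintype.card V)) (h : HasMBE G m) : 5 ≤ m := by
  obtain ⟨f, c, hc, -⟩ := h
  by_contra hlt
  have inj : ∀ v, Function.Injective
      (fun w : G.neighborSet v => c ⟨s(v, (w : V)), w.2⟩) := by
    intro v w w' hw
    by_contra hne
    refine hc ⟨s(v, (w : V)), w.2⟩ ⟨s(v, (w' : V)), w'.2⟩ ?_
      ⟨v, by simp, by simp⟩ hw
    intro e
    apply hne
    have e' := congrArg Subtype.val e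
    simp only [Sym2.congr_right] at e'
    exact Subtype.ext e'
  have hdeg : ∀ v, Fintype.card (G.neighborSet v) = 4 := by
    intro v
    rw [card_neighborSet_eq_degree]
    exact hreg v
  have hm : m = 4 := by
    have := Fintype.card_le_of_injective _ (inj v0)
    rw [hdeg, Fintype.card_fin] at this
    omega
  subst hm
  let M : G.Subgraph :=
    { verts := Set.univ
      Adj := fun v w => ∃ h : G.Adj v w, c ⟨s(v, w), h⟩ = 0
      adj_sub := fun h => h.1
      edge_vert := fun _ => Set.mem_univ _
      symm := by
        constructor
        rintro v w ⟨h, h'⟩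
        refine ⟨h.symm, ?_⟩
        rw [← h']
        congr 1
        exact Subtype.ext Sym2.eq_swap }
  have hM : M.IsPerfectMatching := by
    rw [Subgraph.isPerfectMatching_iff]
    intro v
    have bij := (Fintype.bijective_iff_injective_and_card _).2
      ⟨inj v, by rw [hdeg, Fintype.card_fin]⟩
    obtain ⟨w, hw⟩ := bij.2 0
    refine ⟨w, ⟨w.2, hw⟩, ?_⟩
    rintro w' ⟨h1, h2⟩
    have := inj v (a₁ := ⟨w', h1⟩) (a₂ := w) (by simp only; rw [h2]; exact hw.symm)
    exact congrArg Subtype.val this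
  exact hodd hM.even_card

theorem tg_lower {s t m : ℕ} (ht : 7 ≤ t) (hto : t % 2 = 1) (hst : t ≤ s) (hso : s % 2 = 1)
    (h : HasMBE (toroidalGrid s t) m) : 5 ≤ m := by
  classical
  refine tg_lower_aux (toroidalGrid s t) (fun v => tg_degree (by omega) (by omega) v)
    (⟨0, by omega⟩, ⟨0, by omega⟩) ?_ h
  rw [Fintype.card_prod, Fintype.card_fin, Fintype.card_fin, Nat.even_mul]
  rintro (h | h) <;> rw [Nat.even_iff] at h <;> omega

theorem stmt8 (s t : ℕ) (hso : Odd s) (hto : Odd t) (ht : 7 ≤ t) (hst : t ≤ s) :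
    mbt (toroidalGrid s t) = 5 := by
  rw [Nat.odd_iff] at hso hto
  apply le_antisymm
  · exact Nat.sInf_le (tg_upper ht hto hst hso)
  · exact le_csInf ⟨5, tg_upper ht hto hst hso⟩ (fun m hm => tg_lower ht hto hst hso hm)
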